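/- arXiv:1311.5406 — 2 statements merged into one kernel-verified Lean document; each statement's English description precedes it below -/
import Mathlib

section
/- Let σ₀ > 0 and define sinc : ℝ → ℝ by sinc(t) = sin(t)/t for t ≠ 0 and sinc(0) = 1. Then the sinc kernel K(s, t) = sinc(σ₀(s − t)) is a positive semidefinite kernel on ℝ: for every finite family of reals t₁,…,t_N and reals c₁,…,c_N, Σ_{i,j} c_i c_j sinc(σ₀(t_i − t_j)) ≥ 0. -/
/-- The (unnormalized) sinc function: sinc t = sin t / t for t ≠ 0, and sinc 0 = 1. -/
noncomputable def sinc (t : ℝ) : ℝ := if t = 0 then 1 else Real.sin t / t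

theorem sinc_eq_integral_cos (x : ℝ) : sinc x = ∫ u in (0 : ℝ)..1, Real.cos (x * u) := by
  rcases eq_or_ne x 0 with rfl | hx
  · simp [sinc]
  · rw [intervalIntegral.integral_comp_mul_left (fun u => Real.cos u) hx]
    simp [sinc, hx, div_eq_inv_mul]

theorem sum_sum_mul_cos_sub {ι : Type*} [Fintype ι] (c θ : ι → ℝ) :
    ∑ i, ∑ j, c i * c j * Real.cos (θ i - θ j) =
      (∑ i, c i * Real.cos (θ i)) ^ 2 + (∑ i, c i * Real.sin (θ i)) ^ 2 := by
  simp only [sq, Finset.sum_mul_sum, ← Finset.sum_add_distrib, Real.cos_sub]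
  refine Finset.sum_congr rfl fun i _ => Finset.sum_congr rfl fun j _ => ?_
  ring

/-- For σ₀ > 0, the sinc kernel K(s, t) = sinc(σ₀(s − t)) is a positive semidefinite
kernel on ℝ. -/
theorem sinc_kernel_posSemidef (σ₀ : ℝ) (hσ₀ : 0 < σ₀)
    (N : ℕ) (t : Fin N → ℝ) (c : Fin N → ℝ) :
    0 ≤ ∑ i, ∑ j, c i * c j * sinc (σ₀ * (t i - t j)) := by
  have h : ∑ i, ∑ j, c i * c j * sinc (σ₀ * (t i - t j)) =
      ∫ u in (0 : ℝ)..1, ∑ i, ∑ j, c i * c j * Real.cos (σ₀ * t i * u - σ₀ * t j * u) := by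
    rw [intervalIntegral.integral_finsetSum
      fun i _ => Continuous.intervalIntegrable (by fun_prop) _ _]
    refine Finset.sum_congr rfl fun i _ => ?_
    rw [intervalIntegral.integral_finsetSum
      fun j _ => Continuous.intervalIntegrable (by fun_prop) _ _]
    refine Finset.sum_congr rfl fun j _ => ?_
    rw [intervalIntegral.integral_const_mul, sinc_eq_integral_cos]
    simp only [mul_sub, sub_mul]
  rw [h]
  refine intervalIntegral.integral_nonneg zero_le_one fun u _ => ?_
  rw [sum_sum_mul_cos_sub c fun i => σ₀ * t i * u]
  positivity
end

section
/- Let H be a real inner product space, v₁,…,v_N ∈ H, y₁,…,y_N ∈ ℝ, and L₁,…,L_N : ℝ → ℝ arbitrary loss functions. Define J(w) = ½‖w‖² + Σ_{i=1}^N L_i(y_i − ⟨w, v_i⟩). If w* ∈ H is a global minimizer of J (i.e., J(w*) ≤ J(u) for all u ∈ H), then w* lies in the subspace spanned by v₁,…,v_N; in particular w* = Σ_{i=1}^N η_i v_i for some real coefficients η₁,…,η_N. -/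
open RealInnerProductSpace

/-- Representer theorem: any global minimizer of the regularized empirical objective
J(w) = ½‖w‖² + Σᵢ Lᵢ(yᵢ − ⟨w, vᵢ⟩) lies in the span of v₁,…,v_N; in particular it is
of the form Σᵢ ηᵢ vᵢ. -/
theorem representer_theorem
    {H : Type*} [NormedAddCommGroup H] [InnerProductSpace ℝ H] {N : ℕ}
    (v : Fin N → H) (y : Fin N → ℝ) (L : Fin N → ℝ → ℝ) (w : H)
    (hmin : ∀ u : H,
      (1 / 2) * ‖w‖ ^ 2 + ∑ i, L i (y i - (⟪w, v i⟫ : ℝ))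
        ≤ (1 / 2) * ‖u‖ ^ 2 + ∑ i, L i (y i - (⟪u, v i⟫ : ℝ))) :
    w ∈ Submodule.span ℝ (Set.range v) ∧ ∃ η : Fin N → ℝ, w = ∑ i, η i • v i := by
  set K := Submodule.span ℝ (Set.range v)
  have : FiniteDimensional ℝ K := FiniteDimensional.span_of_finite ℝ (Set.finite_range v)
  have hinner (i : Fin N) : ⟪K.starProjection w, v i⟫ = ⟪w, v i⟫ := by
    rw [K.inner_starProjection_left_eq_right,
      K.starProjection_eq_self_iff.mpr (Submodule.subset_span (Set.mem_range_self i))]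
  have hle : ‖w‖ ≤ ‖K.starProjection w‖ := by
    have h := hmin (K.starProjection w)
    simp only [hinner] at h
    exact (sq_le_sq₀ (norm_nonneg _) (norm_nonneg _)).mp (by linarith)
  have hw : w ∈ K :=
    (K.mem_iff_norm_starProjection w).mpr (le_antisymm (K.norm_starProjection_apply_le w) hle)
  obtain ⟨η, hη⟩ := (Submodule.mem_span_range_iff_exists_fun ℝ).mp hw
  exact ⟨hw, η, hη.symm⟩
end
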